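/- Let G be a finite simple graph of order n, and let a, b, n', m, Δ be non-negative integers with b − Δ ≥ a ≥ 2, δ(G) ≥ b(b−Δ)/(a+Δ) + m + n', and n > (a+b)(a+b+2m−1)/(a+Δ) + n'. Let g, f be integer-valued functions on V(G) with a ≤ g(x) ≤ f(x) − Δ ≤ b − Δ for every vertex x. If for every pair of distinct non-adjacent vertices x, y of G we have max{d_G(x), d_G(y)} ≥ ((b−Δ)n + (a+Δ)n')/(a+b), then G is a fractional (g,f,n',m)-critical deleted graph. -/

import Mathlib

open Classical Finset

/-- The fractional degree `d_G^h(x)` of a vertex: the sum of `h e` over all edges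
(unordered pairs) containing `x`. -/
noncomputable def fracDeg {V : Type*} [Fintype V] [DecidableEq V]
    (h : Sym2 V → ℝ) (x : V) : ℝ :=
  ∑ e ∈ Finset.univ.filter (fun e : Sym2 V => x ∈ e), h e

/-- `G` admits a fractional `(g,f)`-factor: a weighting `h : E(G) → [0,1]`
(extended by `0` off the edge set) with `g x ≤ d_G^h(x) ≤ f x` for every vertex. -/
def HasFracFactor {V : Type*} [Fintype V] [DecidableEq V]
    (G : SimpleGraph V) (g f : V → ℤ) : Prop :=
  ∃ h : Sym2 V → ℝ,
    (∀ e, 0 ≤ h e ∧ h e ≤ 1) ∧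
    (∀ e, e ∉ G.edgeSet → h e = 0) ∧
    (∀ x : V, (g x : ℝ) ≤ fracDeg h x ∧ fracDeg h x ≤ (f x : ℝ))

/-- `G` is a fractional `(g,f,m)`-deleted graph: after deleting any `m` edges,
the resulting graph admits a fractional `(g,f)`-factor. -/
def FracDeleted {V : Type*} [Fintype V] [DecidableEq V]
    (G : SimpleGraph V) (g f : V → ℤ) (m : ℕ) : Prop :=
  ∀ H : Finset (Sym2 V), ↑H ⊆ G.edgeSet → H.card = m →
    HasFracFactor (G.deleteEdges ↑H) g f

/-- `G` is a fractional `(g,f,n',m)`-critical deleted graph: after deleting any `n'`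
vertices, the resulting induced graph is a fractional `(g,f,m)`-deleted graph. -/
def FracCriticalDeleted {V : Type*} [Fintype V] [DecidableEq V]
    (G : SimpleGraph V) (g f : V → ℤ) (n' m : ℕ) : Prop :=
  ∀ U : Finset V, U.card = n' →
    FracDeleted (G.induce ((↑U : Set V)ᶜ)) (fun x => g x.1) (fun x => f x.1) m

/-- `G` is a fractional ID-`(g,f,m)`-deleted graph: after deleting any independent set
of vertices, the resulting induced graph is a fractional `(g,f,m)`-deleted graph. -/
def FracIDDeleted {V : Type*} [Fintype V] [DecidableEq V]
    (G : SimpleGraph V) (g f : V → ℤ) (m : ℕ) : Prop :=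
  ∀ I : Set V, (∀ u ∈ I, ∀ v ∈ I, ¬ G.Adj u v) →
    FracDeleted (G.induce Iᶜ) (fun x => g x.1) (fun x => f x.1) m

/-- A point of smallest Euclidean norm in the image of a convex compact set under a linear map
satisfies the variational inequality. -/
lemma exists_variational_point {E W : Type*} [AddCommGroup E] [Module ℝ E] [TopologicalSpace E]
    [Fintype W] (K : Set E) (hK : IsCompact K) (hne : K.Nonempty) (hconv : Convex ℝ K)
    (L : E →ₗ[ℝ] (W → ℝ)) (hL : Continuous L) :
    ∃ z ∈ K, ∀ z' ∈ K, 0 ≤ ∑ x, L z x * (L z' x - L z x) := by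
  obtain ⟨z, hz, hmin⟩ := hK.exists_isMinOn hne
    (f := fun z => ∑ x, (L z x) ^ 2) (by
      apply Continuous.continuousOn
      exact continuous_finsetSum _ fun x _ => ((continuous_apply x).comp hL).pow 2)
  refine ⟨z, hz, fun z' hz' => ?_⟩
  by_contra! hneg
  set A := ∑ x, L z x * (L z' x - L z x) with hA
  set B := ∑ x, (L z' x - L z x) ^ 2 with hB
  have hB0 : 0 ≤ B := Finset.sum_nonneg fun x _ => sq_nonneg _
  have hpos : 0 < B - A := by linarith
  set t := -A / (B - A) with ht
  have ht0 : 0 < t := div_pos (by linarith) hpos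
  have ht1 : t ≤ 1 := by rw [ht, div_le_one hpos]; linarith
  have hmem : z + t • (z' - z) ∈ K := hconv.add_smul_sub_mem hz hz' ⟨ht0.le, ht1⟩
  have h1 := hmin hmem
  have h2 : ∑ x, (L (z + t • (z' - z)) x) ^ 2 = ∑ x, (L z x) ^ 2 + 2 * t * A + t ^ 2 * B := by
    rw [hA, hB, Finset.mul_sum, Finset.mul_sum, ← Finset.sum_add_distrib,
      ← Finset.sum_add_distrib]
    refine Finset.sum_congr rfl fun x _ => ?_
    simp only [map_add, map_smul, map_sub, Pi.add_apply, Pi.smul_apply, Pi.sub_apply, smul_eq_mul]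
    ring
  simp only [Set.mem_ofPred_eq] at h1
  rw [h2] at h1
  have h3 : t * (B - A) = -A := by rw [ht]; field_simp
  have h4 : 0 ≤ t * (2 * A + t * B) := by nlinarith
  have h5 : 0 ≤ 2 * A + t * B := by
    by_contra! h
    nlinarith [mul_neg_of_pos_of_neg ht0 h]
  nlinarith

lemma fracDeg_eq_sum {W : Type*} [Fintype W] [DecidableEq W] (h : Sym2 W → ℝ) (x : W) :
    fracDeg h x = ∑ y, h s(x, y) := by
  unfold fracDeg
  symm
  refine Finset.sum_bij (fun y _ => s(x, y)) ?_ ?_ ?_ ?_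
  · simp
  · intro y _ z _ hyz
    exact Sym2.congr_right.1 hyz
  · intro e he
    simp only [Finset.mem_filter, Finset.mem_univ, true_and] at he
    obtain ⟨y, rfl⟩ := Sym2.mem_iff_exists.1 he
    exact ⟨y, by simp, rfl⟩
  · simp

/-- The linear map sending `(h, c)` to `x ↦ c x - d^h(x)`. -/
noncomputable def slackMap (W : Type*) [Fintype W] [DecidableEq W] :
    ((Sym2 W → ℝ) × (W → ℝ)) →ₗ[ℝ] (W → ℝ) where
  toFun z x := z.2 x - ∑ y, z.1 s(x, y)
  map_add' z w := by
    ext x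
    simp [Finset.sum_add_distrib]
    ring
  map_smul' r z := by
    ext x
    simp [← Finset.mul_sum]
    ring

lemma slackMap_apply {W : Type*} [Fintype W] [DecidableEq W]
    (z : (Sym2 W → ℝ) × (W → ℝ)) (x : W) :
    slackMap W z x = z.2 x - ∑ y, z.1 s(x, y) := rfl

lemma exists_slack {W : Type*} [Fintype W] [DecidableEq W]
    (G : SimpleGraph W) (g f : W → ℝ) (hgf : ∀ x, g x ≤ f x) :
    ∃ (h : Sym2 W → ℝ) (c y : W → ℝ), (∀ e, 0 ≤ h e ∧ h e ≤ 1) ∧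
      (∀ e, e ∉ G.edgeSet → h e = 0) ∧ (∀ x, g x ≤ c x ∧ c x ≤ f x) ∧
      (∀ x, c x - ∑ v, h s(x, v) = y x) ∧
      (∀ x, 0 < y x → c x = g x) ∧ (∀ x, y x < 0 → c x = f x) ∧
      (∀ u v, G.Adj u v → 0 < y u + y v → h s(u, v) = 1) ∧
      (∀ u v, G.Adj u v → y u + y v < 0 → h s(u, v) = 0) := by
  set ub : Sym2 W → ℝ := fun e => if e ∈ G.edgeSet then 1 else 0 with hub
  have hub0 : ∀ e, 0 ≤ ub e := fun e => by simp only [hub]; split_ifs <;> norm_num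
  set K : Set ((Sym2 W → ℝ) × (W → ℝ)) := Set.Icc 0 ub ×ˢ Set.Icc g f with hK
  obtain ⟨⟨h, c⟩, hz, hvar⟩ := exists_variational_point K
    (isCompact_Icc.prod isCompact_Icc)
    (⟨(0, g), ⟨⟨le_rfl, hub0⟩, ⟨le_rfl, hgf⟩⟩⟩)
    ((convex_Icc _ _).prod (convex_Icc _ _)) (slackMap W) (by
      refine continuous_pi fun x => ?_
      simp only [slackMap_apply]
      fun_prop)
  obtain ⟨⟨hh0, hh1⟩, ⟨hc0, hc1⟩⟩ := hz
  simp only at hh0 hh1 hc0 hc1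
  have hcvar : ∀ (x : W) (r : ℝ), g x ≤ r → r ≤ f x →
      0 ≤ slackMap W (h, c) x * (r - c x) := by
    intro x r hr0 hr1
    have := hvar (h, Function.update c x r) ⟨⟨hh0, hh1⟩, by
      constructor <;> intro v <;> by_cases hv : v = x
      · subst hv; simpa using hr0
      · simpa [hv] using hc0 v
      · subst hv; simpa using hr1
      · simpa [hv] using hc1 v⟩
    refine this.trans_eq ?_
    rw [Finset.sum_eq_single x]
    · simp [slackMap_apply]
    · intro v _ hv
      simp [slackMap_apply, hv]
    · simp
  have hhvar : ∀ (u v : W) (r : ℝ), G.Adj u v → 0 ≤ r → r ≤ 1 →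
      0 ≤ (slackMap W (h, c) u + slackMap W (h, c) v) * (h s(u, v) - r) := by
    intro u v r huv hr0 hr1
    have := hvar (Function.update h s(u, v) r, c) ⟨by
      constructor <;> intro e <;> by_cases he : e = s(u, v)
      · subst he; simpa using hr0
      · simpa [he] using hh0 e
      · subst he; simpa [hub, huv] using hr1
      · simpa [he] using hh1 e, hc0, hc1⟩
    refine this.trans_eq ?_
    have key : ∀ x, slackMap W (Function.update h s(u, v) r, c) x - slackMap W (h, c) x =
        (if x = u then h s(u, v) - r else 0) + (if x = v then h s(u, v) - r else 0) := by
      intro x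
      simp only [slackMap_apply]
      have : ∀ w, Function.update h s(u, v) r s(x, w) = h s(x, w)
          - ((if x = u then (if w = v then h s(u, v) - r else 0) else 0) +
            (if x = v then (if w = u then h s(u, v) - r else 0) else 0)) := by
        intro w
        have hne := huv.ne
        by_cases he : s(x, w) = s(u, v)
        · rw [he, Function.update_self]
          rcases Sym2.eq_iff.1 he with ⟨rfl, rfl⟩ | ⟨rfl, rfl⟩
          · simp [hne]
          · simp [hne.symm]
        · rw [Function.update_of_ne he]
          have h1 : ¬ (x = u ∧ w = v) := fun h => he (by rw [h.1, h.2])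
          have h2 : ¬ (x = v ∧ w = u) := fun h => he (by rw [h.1, h.2, Sym2.eq_swap])
          by_cases a1 : x = u <;> by_cases a2 : x = v <;> simp_all
      simp only [this, Finset.sum_sub_distrib, Finset.sum_add_distrib]
      by_cases a1 : x = u <;> by_cases a2 : x = v <;> simp [a1, a2]
    simp only [key, mul_add, Finset.sum_add_distrib, mul_ite, mul_zero, Finset.sum_ite_eq',
      Finset.mem_univ, if_true]
    ring
  have hle1 : ∀ e, h e ≤ 1 := fun e => (hh1 e).trans (by simp only [hub]; split_ifs <;> norm_num)
  refine ⟨h, c, slackMap W (h, c), fun e => ⟨hh0 e, hle1 e⟩, ?_, fun x => ⟨hc0 x, hc1 x⟩,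
    fun x => rfl, ?_, ?_, ?_, ?_⟩
  · intro e he
    have := hh1 e
    simp only [hub, he, if_false] at this
    exact le_antisymm this (hh0 e)
  · intro x hx
    have := hcvar x (g x) le_rfl (hgf x)
    have := nonneg_of_mul_nonneg_right this hx
    linarith [hc0 x]
  · intro x hx
    have h1 := hcvar x (f x) (hgf x) le_rfl
    by_contra hne
    have h2 : c x < f x := lt_of_le_of_ne (hc1 x) hne
    nlinarith
  · intro u v huv hy
    have := nonneg_of_mul_nonneg_right (hhvar u v 1 huv zero_le_one le_rfl) hy
    linarith [hle1 s(u, v)]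
  · intro u v huv hy
    have h1 := hhvar u v 0 huv le_rfl zero_le_one
    by_contra hne
    have h2 : 0 < h s(u, v) := lt_of_le_of_ne (hh0 _) (Ne.symm hne)
    nlinarith

/-- Sufficiency in Anstee's characterization of graphs with a fractional `(g,f)`-factor. -/
theorem hasFracFactor_of_cut {W : Type*} [Fintype W] [DecidableEq W]
    (G : SimpleGraph W) (g f : W → ℤ) (hgf : ∀ x, g x ≤ f x)
    (hcut : ∀ S T : Finset W, Disjoint S T →
      ∑ x ∈ T, g x ≤ ∑ x ∈ S, f x + ∑ x ∈ T, (#{v | v ∉ S ∧ G.Adj x v} : ℤ)) :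
    HasFracFactor G g f := by
  obtain ⟨h, c, y, h01, hsupp, hc, hy, hpos, hneg, hone, hzero⟩ :=
    exists_slack G (fun x => (g x : ℝ)) (fun x => (f x : ℝ)) (fun x => by exact_mod_cast hgf x)
  by_cases hall : ∀ x, y x = 0
  · refine ⟨h, h01, hsupp, fun x => ?_⟩
    rw [fracDeg_eq_sum]
    have h1 := hy x
    rw [hall x] at h1
    have h2 := hc x
    constructor <;> linarith
  exfalso
  push Not at hall
  obtain ⟨x₀, hx₀⟩ := hall
  have : Nonempty W := ⟨x₀⟩
  obtain ⟨xm, hxm⟩ := Finite.exists_max (fun x => |y x|)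
  set M := |y xm| with hM
  have hMpos : 0 < M := lt_of_lt_of_le (abs_pos.2 hx₀) (hxm x₀)
  have hub : ∀ x, y x ≤ M := fun x => (le_abs_self _).trans (hxm x)
  have hlb : ∀ x, -M ≤ y x := fun x => by linarith [neg_abs_le (y x), hxm x]
  set T : Finset W := {x | y x = M} with hT
  set S : Finset W := {x | y x = -M} with hS
  have memT : ∀ x, x ∈ T ↔ y x = M := fun x => by simp [hT]
  have memS : ∀ x, x ∈ S ↔ y x = -M := fun x => by simp [hS]
  have hdisj : Disjoint S T := by
    rw [Finset.disjoint_left]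
    intro x hxS hxT
    rw [memS] at hxS
    rw [memT] at hxT
    linarith
  have hrowT : ∀ x ∈ T, (g x : ℝ) - M = (#{v | v ∉ S ∧ G.Adj x v} : ℝ) + ∑ v ∈ S, h s(x, v) := by
    intro x hx
    have hx' := (memT x).1 hx
    have h1 := hy x
    rw [hpos x (by linarith), hx'] at h1
    have h2 : ∑ v, h s(x, v) = ∑ v, ((if v ∉ S ∧ G.Adj x v then (1 : ℝ) else 0) +
        (if v ∈ S then h s(x, v) else 0)) := by
      refine Finset.sum_congr rfl fun v _ => ?_
      by_cases hv : v ∈ S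
      · simp [hv]
      · by_cases hadj : G.Adj x v
        · have : y v ≠ -M := fun hh => hv ((memS v).2 hh)
          have : -M < y v := lt_of_le_of_ne (hlb v) (Ne.symm this)
          simp [hv, hadj, hone x v hadj (by linarith)]
        · simp [hv, hadj, hsupp s(x, v) (by simpa using hadj)]
    rw [h2, Finset.sum_add_distrib, Finset.sum_boole, Finset.sum_ite_mem, Finset.univ_inter] at h1
    linarith
  have hrowS : ∀ x ∈ S, (f x : ℝ) + M = ∑ v ∈ T, h s(v, x) := by
    intro x hx
    have hx' := (memS x).1 hx
    have h1 := hy x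
    rw [hneg x (by linarith), hx'] at h1
    have h2 : ∑ v, h s(x, v) = ∑ v, (if v ∈ T then h s(v, x) else 0) := by
      refine Finset.sum_congr rfl fun v _ => ?_
      by_cases hv : v ∈ T
      · rw [if_pos hv, Sym2.eq_swap]
      · rw [if_neg hv]
        by_cases hadj : G.Adj x v
        · have : y v ≠ M := fun hh => hv ((memT v).2 hh)
          have : y v < M := lt_of_le_of_ne (hub v) this
          exact hzero x v hadj (by linarith)
        · exact hsupp s(x, v) (by simpa using hadj)
    rw [h2, Finset.sum_ite_mem, Finset.univ_inter] at h1
    linarith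
  have hsumT := Finset.sum_congr rfl hrowT
  have hsumS := Finset.sum_congr rfl hrowS
  rw [Finset.sum_comm] at hsumS
  simp only [Finset.sum_sub_distrib, Finset.sum_add_distrib, Finset.sum_const, nsmul_eq_mul]
    at hsumT hsumS
  have hST : (0 : ℝ) < (#S : ℝ) * M + #T * M := by
    have hxm' : xm ∈ S ∨ xm ∈ T := by
      rw [memS, memT]
      rcases abs_choice (y xm) with h | h
      · right; rw [hM, h]
      · left; rw [hM, h]; ring
    rcases hxm' with h | h
    · have : (0 : ℝ) < #S := Nat.cast_pos.2 (Finset.card_pos.2 ⟨_, h⟩)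
      exact add_pos_of_pos_of_nonneg (mul_pos this hMpos) (mul_nonneg (Nat.cast_nonneg _) hMpos.le)
    · have : (0 : ℝ) < #T := Nat.cast_pos.2 (Finset.card_pos.2 ⟨_, h⟩)
      exact add_pos_of_nonneg_of_pos (mul_nonneg (Nat.cast_nonneg _) hMpos.le) (mul_pos this hMpos)
  have hcutR : ∑ x ∈ T, (g x : ℝ) ≤
      ∑ x ∈ S, (f x : ℝ) + ∑ x ∈ T, (#{v | v ∉ S ∧ G.Adj x v} : ℝ) := by
    exact_mod_cast hcut S T hdisj
  linarith

lemma sum_card_incident_le {W : Type*} [DecidableEq W] (H : Finset (Sym2 W)) (T : Finset W) :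
    ∑ x ∈ T, #{e ∈ H | x ∈ e} ≤ 2 * #H := by
  have h := Finset.sum_card_bipartiteAbove_eq_sum_card_bipartiteBelow
    (s := T) (t := H) (fun (x : W) e => x ∈ e)
  unfold Finset.bipartiteAbove Finset.bipartiteBelow at h
  rw [h, mul_comm, ← smul_eq_mul]
  refine Finset.sum_le_card_nsmul _ _ _ fun e _ => ?_
  induction e with
  | _ u v =>
    refine (Finset.card_le_card (t := {u, v}) ?_).trans Finset.card_le_two
    intro x hx
    simpa using (Finset.mem_filter.1 hx).2

lemma card_adj_le_deleteEdges {W : Type*} [Fintype W] [DecidableEq W] (G : SimpleGraph W)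
    (H : Finset (Sym2 W)) (S : Finset W) (x : W) :
    #{v | v ∉ S ∧ G.Adj x v} ≤
      #{v | v ∉ S ∧ (G.deleteEdges (H : Set (Sym2 W))).Adj x v} + #{e ∈ H | x ∈ e} := by
  have h1 : ({v | v ∉ S ∧ G.Adj x v} : Finset W) ⊆
      ({v | v ∉ S ∧ (G.deleteEdges (H : Set (Sym2 W))).Adj x v} : Finset W) ∪
        ({v | s(x, v) ∈ H} : Finset W) := by
    intro v hv
    simp only [Finset.mem_filter, Finset.mem_univ, true_and, Finset.mem_union,
      SimpleGraph.deleteEdges_adj, Finset.mem_coe] at hv ⊢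
    tauto
  refine (Finset.card_le_card h1).trans ((Finset.card_union_le _ _).trans ?_)
  gcongr
  refine Finset.card_le_card_of_injOn (fun v => s(x, v)) ?_ ?_
  · intro v hv
    simpa using hv
  · intro u _ v _ huv
    exact Sym2.congr_right.1 huv

/-- Final estimate when the low-degree threshold `w` lies between `1` and `β`. -/
lemma threshold_estimate (α β m p s k w : ℤ) (hα : 2 ≤ α) (hβ : 2 ≤ β) (hm : 0 ≤ m)
    (hp : (α + β) * (α + β + 2 * m - 1) < α * p)
    (hw1 : 1 ≤ w) (hwβ : w ≤ β) (hw : β * p ≤ (α + β) * (w + s)) :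
    0 ≤ α * s + (p - s) * (w - β) + k * (k - 1 - w) - 2 * m := by
  have hN : 0 < α + β := by linarith
  have e1 : (α + β) * (α * s + (p - s) * (w - β)) =
      α * p * w + (β * p - (α + β) * s) * (w - β - α) := by ring
  have e2 : (α + β) * w * (w - β - α) ≤ (β * p - (α + β) * s) * (w - β - α) :=
    mul_le_mul_of_nonpos_right (by linarith) (by linarith)
  have e3 : ((α + β) * (α + β + 2 * m - 1) + 1) * w ≤ α * p * w :=
    mul_le_mul_of_nonneg_right hp (by linarith)
  have e4 : (α + β) * (w * (2 * m - 1 + w)) < (α + β) * (α * s + (p - s) * (w - β)) := by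
    nlinarith
  have e5 := lt_of_mul_lt_mul_left e4 hN.le
  have e6 : -1 ≤ w * (2 * m - 1 + w) + k * (k - 1 - w) - 2 * m := by
    rcases hw1.eq_or_lt with h | h
    · subst h; nlinarith [sq_nonneg (k - 1)]
    · have : 0 ≤ (w - 1) * m := mul_nonneg (by linarith) hm
      nlinarith [sq_nonneg (2 * k - w - 1), sq_nonneg (w - 2)]
  linarith

theorem hasFracFactor_deleteEdges {W : Type*} [Fintype W] [DecidableEq W]
    (G : SimpleGraph W) (H : Finset (Sym2 W)) (g f : W → ℤ) (α β b : ℤ)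
    (hα : 2 ≤ α) (hβ : 2 ≤ β) (hαb : α ≤ b) (hβb : β ≤ b)
    (hgf : ∀ x, g x ≤ f x) (hg : ∀ x, g x ≤ β) (hf : ∀ x, α ≤ f x)
    (hmin : ∀ x, b * β + α * #H ≤ α * #{v | G.Adj x v})
    (hp : (α + β) * (α + β + 2 * #H - 1) < α * Fintype.card W)
    (hdeg : ∀ x y, x ≠ y → ¬ G.Adj x y →
      β * Fintype.card W ≤ (α + β) * #{v | G.Adj x v} ∨
        β * Fintype.card W ≤ (α + β) * #{v | G.Adj y v}) :
    HasFracFactor (G.deleteEdges (H : Set (Sym2 W))) g f := by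
  refine hasFracFactor_of_cut _ _ _ hgf fun S T hST => ?_
  set d : W → ℤ := fun x => (#{v | v ∉ S ∧ (G.deleteEdges (H : Set (Sym2 W))).Adj x v} : ℤ) with hd
  set D : W → ℤ := fun x => (#{v | v ∉ S ∧ G.Adj x v} : ℤ) with hD
  set η : W → ℤ := fun x => (#{e ∈ H | x ∈ e} : ℤ) with hη
  set s : ℤ := (#S : ℤ) with hs
  set m : ℤ := (#H : ℤ) with hm
  set p : ℤ := (Fintype.card W : ℤ) with hpW
  have hm0 : 0 ≤ m := by positivity
  have hs0 : 0 ≤ s := by positivity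
  have hd0 : ∀ x, 0 ≤ d x := fun x => by positivity
  have hηm : ∀ x, η x ≤ m := fun x =>
    Int.ofNat_le.2 (Finset.card_filter_le _ _)
  have hDd : ∀ x, D x ≤ d x + η x := fun x => by
    simp only [hD, hd, hη]
    exact_mod_cast card_adj_le_deleteEdges G H S x
  have hηsum : ∑ x ∈ T, η x ≤ 2 * m := by
    simp only [hη, hm]
    exact_mod_cast sum_card_incident_le H T
  have hDs : ∀ x, (#{v | G.Adj x v} : ℤ) ≤ D x + s := by
    intro x
    have h1 : ({v | G.Adj x v} : Finset W) ⊆ ({v | v ∉ S ∧ G.Adj x v} : Finset W) ∪ S := by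
      intro v hv
      simp only [Finset.mem_filter, Finset.mem_univ, true_and, Finset.mem_union] at hv ⊢
      tauto
    simp only [hD, hs]
    exact_mod_cast (Finset.card_le_card h1).trans (Finset.card_union_le _ _)
  have hminD : ∀ x, b * β + α * m ≤ α * (D x + s) := fun x =>
    (hmin x).trans (mul_le_mul_of_nonneg_left (hDs x) (by linarith))
  have hcard : s + #T ≤ p := by
    have h1 := Finset.card_le_univ (S ∪ T)
    rw [Finset.card_union_of_disjoint hST] at h1
    simp only [hs, hpW]
    exact_mod_cast h1
  have hfS : α * s ≤ ∑ x ∈ S, f x := by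
    have := Finset.card_nsmul_le_sum S f α fun x _ => hf x
    rw [nsmul_eq_mul] at this
    linarith
  have hgT : ∑ x ∈ T, g x ≤ β * #T := by
    have := Finset.sum_le_card_nsmul T g β fun x _ => hg x
    rw [nsmul_eq_mul] at this
    linarith
  have hDsum : ∑ x ∈ T, D x ≤ ∑ x ∈ T, d x + ∑ x ∈ T, η x := by
    rw [← Finset.sum_add_distrib]
    exact Finset.sum_le_sum fun x _ => hDd x
  suffices hmain : β * #T ≤ α * s + ∑ x ∈ T, d x from
    hgT.trans (hmain.trans (add_le_add hfS (Finset.sum_le_sum fun x _ =>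
      le_of_eq (by simp only [hd]; congr!))))
  have hN : 0 < α + β := by linarith
  -- the case of a large `S`
  by_cases hlarge : β * p ≤ (α + β) * s
  · have h1 : 0 ≤ ∑ x ∈ T, d x := Finset.sum_nonneg fun x _ => hd0 x
    have h2 := mul_le_mul_of_nonneg_left hcard (by linarith : 0 ≤ β)
    linarith
  push Not at hlarge
  obtain ⟨w, hw1, hw, hwD⟩ : ∃ w : ℤ, 1 ≤ w ∧ β * p ≤ (α + β) * (w + s) ∧
      ∀ z, β * p ≤ (α + β) * (z + s) → w ≤ z := by
    obtain ⟨w, hw, hmin⟩ := Int.exists_least_of_bdd (P := fun z => β * p ≤ (α + β) * (z + s))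
      ⟨0, fun z hz => by
        by_contra! hneg
        nlinarith⟩ ⟨β * p, by
        have : 0 ≤ β * p := by positivity
        nlinarith [mul_nonneg hN.le hs0]⟩
    refine ⟨w, ?_, hw, hmin⟩
    by_contra! hneg
    nlinarith
  -- the low-degree vertices of `T` form a clique
  set K : Finset W := {x ∈ T | (α + β) * #{v | G.Adj x v} < β * p} with hK
  have hKT : K ⊆ T := Finset.filter_subset _ _
  have hKD : ∀ x ∈ K, (#K : ℤ) - 1 ≤ D x := by
    intro x hx
    have hsub : K.erase x ⊆ ({v | v ∉ S ∧ G.Adj x v} : Finset W) := by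
      intro v hv
      obtain ⟨hvx, hvK⟩ := Finset.mem_erase.1 hv
      simp only [Finset.mem_filter, Finset.mem_univ, true_and]
      refine ⟨fun hvS => (Finset.disjoint_left.1 hST hvS) (hKT hvK), ?_⟩
      by_contra hnadj
      have hx2 := (Finset.mem_filter.1 hx).2
      have hv2 := (Finset.mem_filter.1 hvK).2
      rcases hdeg x v hvx.symm hnadj with h | h <;> linarith
    have h1 := Finset.card_le_card hsub
    rw [Finset.card_erase_of_mem hx] at h1
    simp only [hD]
    omega
  have hRD : ∀ x ∈ T \ K, w ≤ D x := by
    intro x hx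
    obtain ⟨hxT, hxK⟩ := Finset.mem_sdiff.1 hx
    have : β * p ≤ (α + β) * #{v | G.Adj x v} := by
      by_contra! hlt
      exact hxK (Finset.mem_filter.2 ⟨hxT, hlt⟩)
    exact hwD _ (this.trans (mul_le_mul_of_nonneg_left (hDs x) hN.le))
  have hsplit : ∑ x ∈ T \ K, D x + ∑ x ∈ K, D x = ∑ x ∈ T, D x := Finset.sum_sdiff hKT
  have hcsplit : (#(T \ K) : ℤ) + #K = #T := by exact_mod_cast Finset.card_sdiff_add_card_eq_card hKT
  have hRsum : #(T \ K) * w ≤ ∑ x ∈ T \ K, D x := by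
    simpa [nsmul_eq_mul] using Finset.card_nsmul_le_sum (T \ K) D w hRD
  have hKsum : ∀ c : ℤ, (∀ x ∈ K, c ≤ D x) → #K * c ≤ ∑ x ∈ K, D x := fun c hc => by
    simpa [nsmul_eq_mul] using Finset.card_nsmul_le_sum K D c hc
  have hr0 : (0 : ℤ) ≤ #(T \ K) := by positivity
  rcases le_or_gt w β with hwβ | hwβ
  · have h1 := threshold_estimate α β m p s #K w hα hβ hm0 hp hw1 hwβ hw
    have h2 := hKsum _ hKD
    have h3 : (p - s) * (w - β) ≤ (#(T \ K) + #K : ℤ) * (w - β) :=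
      mul_le_mul_of_nonpos_right (by linarith) (by linarith)
    rw [← hcsplit]
    linarith
  rcases T.eq_empty_or_nonempty with hTe | hTne
  · rw [hTe]
    simp only [Finset.card_empty, Finset.sum_empty]
    push_cast
    linarith [mul_nonneg (by linarith : 0 ≤ α) hs0]
  obtain ⟨x₁, hx₁, hx₁min⟩ := Finset.exists_min_image T D hTne
  have hs1 := hminD x₁
  rcases le_or_gt (D x₁) β with hD1 | hD1
  · have hx₁K : x₁ ∈ K := by
      by_contra hnot
      linarith [hRD x₁ (Finset.mem_sdiff.2 ⟨hx₁, hnot⟩)]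
    have hk1 := hKD x₁ hx₁K
    have h2 := hKsum (D x₁) fun x hx => hx₁min x (hKT hx)
    have h3 : (#(T \ K) : ℤ) * β ≤ #(T \ K) * w := mul_le_mul_of_nonneg_left hwβ.le hr0
    have hD10 : 0 ≤ D x₁ := by positivity
    have h4 : #K * (β - D x₁) ≤ b * β - α * D x₁ := by
      rcases le_or_gt (#K : ℤ) b with hkb | hkb
      · linarith [mul_le_mul_of_nonneg_right hkb (sub_nonneg.2 hD1),
          mul_le_mul_of_nonneg_right hαb hD10]
      · have : D x₁ = β := by linarith
        rw [this]
        linarith [mul_le_mul_of_nonneg_right hαb (by linarith : 0 ≤ β)]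
    have h5 : 2 * m ≤ α * m := mul_le_mul_of_nonneg_right hα hm0
    rw [← hcsplit]
    linarith
  · obtain ⟨t, ht⟩ : ∃ t, D x₁ = β + t := ⟨D x₁ - β, by ring⟩
    have ht0 : 0 < t := by linarith
    have hterm : ∀ x ∈ T, β + t - η x ≤ d x := fun x hx => by
      linarith [hx₁min x hx, hDd x]
    have hsumd : #T * (β + t) - ∑ x ∈ T, η x ≤ ∑ x ∈ T, d x := by
      have := Finset.sum_le_sum hterm
      simpa [Finset.sum_sub_distrib, nsmul_eq_mul] using this
    rcases le_or_gt m t with hmt | hmt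
    · have : #T • β ≤ ∑ x ∈ T, d x :=
        Finset.card_nsmul_le_sum T d β fun x hx => by linarith [hterm x hx, hηm x]
      rw [nsmul_eq_mul] at this
      linarith [mul_nonneg (by linarith : 0 ≤ α) hs0]
    · have h5 : 2 * (m - t) ≤ α * (m - t) := mul_le_mul_of_nonneg_right hα (by linarith)
      have h6 : α * β ≤ b * β := mul_le_mul_of_nonneg_right hαb (by linarith)
      have h7 : 2 * (m - t) ≤ α * s := by rw [ht] at hs1; linarith
      rcases (Nat.one_le_iff_ne_zero.2 hTne.card_ne_zero).eq_or_lt with h1 | h1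
      · obtain ⟨x, hx⟩ := Finset.card_eq_one.1 h1.symm
        subst hx
        simp only [Finset.sum_singleton, Finset.card_singleton] at hsumd ⊢
        push_cast at hsumd ⊢
        linarith [hηm x]
      · have : (2 : ℤ) ≤ #T := by exact_mod_cast h1
        linarith [mul_le_mul_of_nonneg_right this ht0.le]

lemma degree_le_induce_compl {V : Type*} [Fintype V] [DecidableEq V]
    (G : SimpleGraph V) [DecidableRel G.Adj] (U : Finset V)
    [Fintype ((U : Set V)ᶜ : Set V)] (x : ((U : Set V)ᶜ : Set V)) :
    G.degree x.1 ≤ #{v | (G.induce ((U : Set V)ᶜ)).Adj x v} + #U := by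
  have h1 : G.neighborFinset x.1 ⊆
      ({v | (G.induce ((U : Set V)ᶜ)).Adj x v} : Finset _).image Subtype.val ∪ U := by
    intro v hv
    rw [SimpleGraph.mem_neighborFinset] at hv
    by_cases hvU : v ∈ U
    · exact Finset.mem_union_right _ hvU
    · refine Finset.mem_union_left _ (Finset.mem_image.2 ⟨⟨v, by simpa using hvU⟩, ?_, rfl⟩)
      simpa using hv
  rw [← SimpleGraph.card_neighborFinset_eq_degree]
  refine (Finset.card_le_card h1).trans ((Finset.card_union_le _ _).trans ?_)
  gcongr
  exact Finset.card_image_le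

theorem statement_2 {V : Type*} [Fintype V] [DecidableEq V]
    (G : SimpleGraph V) [DecidableRel G.Adj] (a b n' m Δ : ℕ) (g f : V → ℤ)
    (hba : a + Δ ≤ b) (ha : 2 ≤ a)
    (hmin : ∀ v : V, (G.degree v : ℝ) ≥
      (b : ℝ) * ((b : ℝ) - Δ) / ((a : ℝ) + Δ) + m + n')
    (hn : (Fintype.card V : ℝ) >
      ((a : ℝ) + b) * ((a : ℝ) + b + 2 * m - 1) / ((a : ℝ) + Δ) + n')
    (hgf : ∀ x : V, (a : ℤ) ≤ g x ∧ g x ≤ f x - (Δ : ℤ) ∧ f x - (Δ : ℤ) ≤ (b : ℤ) - (Δ : ℤ))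
    (hdeg : ∀ x y : V, x ≠ y → ¬ G.Adj x y →
      ((max (G.degree x) (G.degree y) : ℕ) : ℝ) ≥
        (((b : ℝ) - Δ) * Fintype.card V + ((a : ℝ) + Δ) * n') / ((a : ℝ) + b)) :
    FracCriticalDeleted G g f n' m := by
  intro U hU H _ hHm
  have hαpos : (0 : ℝ) < (a : ℝ) + Δ := by
    have : (0 : ℝ) < a := by exact_mod_cast (by omega : 0 < a)
    positivity
  have hab : (0 : ℝ) < (a : ℝ) + b := by
    have : (0 : ℝ) < a := by exact_mod_cast (by omega : 0 < a)
    positivity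
  have hcard : (Fintype.card ((U : Set V)ᶜ : Set V) : ℝ) + n' = Fintype.card V := by
    have h1 : Fintype.card ((U : Set V)ᶜ : Set V) = #Uᶜ := by
      rw [← Set.toFinset_card]
      congr 1
      ext
      simp
    have h2 := Finset.card_add_card_compl U
    rw [h1]
    rw [hU] at h2
    exact_mod_cast (by omega : #Uᶜ + n' = Fintype.card V)
  have hdegR : ∀ x : ((U : Set V)ᶜ : Set V),
      (G.degree x.1 : ℝ) ≤ (#{v | (G.induce ((U : Set V)ᶜ)).Adj x v} : ℝ) + n' := fun x => by
    have := degree_le_induce_compl G U x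
    rw [hU] at this
    exact_mod_cast this
  refine hasFracFactor_deleteEdges _ H _ _ ((a : ℤ) + Δ) ((b : ℤ) - Δ) b ?_ ?_ ?_ ?_ ?_ ?_ ?_
    ?_ ?_ ?_
  · omega
  · omega
  · omega
  · omega
  · intro x
    have := hgf x.1
    omega
  · intro x
    have := hgf x.1
    omega
  · intro x
    have := hgf x.1
    omega
  · intro x
    have h1 := hmin x.1
    have h2 := hdegR x
    have h3 : (b : ℝ) * ((b : ℝ) - Δ) / ((a : ℝ) + Δ) ≤
        (#{v | (G.induce ((U : Set V)ᶜ)).Adj x v} : ℝ) - m := by linarith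
    rw [div_le_iff₀ hαpos] at h3
    rw [hHm]
    have h4 : (b : ℝ) * ((b : ℝ) - Δ) + ((a : ℝ) + Δ) * m ≤
        ((a : ℝ) + Δ) * (#{v | (G.induce ((U : Set V)ᶜ)).Adj x v} : ℝ) := by linarith
    have h5 : (b : ℤ) * ((b : ℤ) - Δ) + ((a : ℤ) + Δ) * m ≤
        ((a : ℤ) + Δ) * #{v | (G.induce ((U : Set V)ᶜ)).Adj x v} := by exact_mod_cast h4
    convert h5
  · have h3 : ((a : ℝ) + b) * ((a : ℝ) + b + 2 * m - 1) / ((a : ℝ) + Δ) <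
        (Fintype.card ((U : Set V)ᶜ : Set V) : ℝ) := by linarith
    rw [div_lt_iff₀ hαpos] at h3
    rw [hHm]
    have h4 : (((a : ℝ) + Δ) + (b - Δ)) * (((a : ℝ) + Δ) + (b - Δ) + 2 * m - 1) <
        ((a : ℝ) + Δ) * (Fintype.card ((U : Set V)ᶜ : Set V) : ℝ) := by linarith
    exact_mod_cast h4
  · intro x y hxy hnadj
    have h1 := hdeg x.1 y.1 (fun h => hxy (Subtype.ext h)) hnadj
    rw [ge_iff_le, div_le_iff₀ hab, ← hcard] at h1
    have key : ∀ z : ((U : Set V)ᶜ : Set V),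
        ((b : ℝ) - Δ) * (Fintype.card ((U : Set V)ᶜ : Set V) + n') + ((a : ℝ) + Δ) * n' ≤
          (G.degree z.1 : ℝ) * ((a : ℝ) + b) →
        ((b : ℤ) - Δ) * Fintype.card ((U : Set V)ᶜ : Set V) ≤
          ((a : ℤ) + Δ + (b - Δ)) * #{v | (G.induce ((U : Set V)ᶜ)).Adj z v} := by
      intro z hz
      have h2 := mul_le_mul_of_nonneg_right (hdegR z) hab.le
      have h4 : ((b : ℝ) - Δ) * Fintype.card ((U : Set V)ᶜ : Set V) ≤
          ((a : ℝ) + Δ + (b - Δ)) * #{v | (G.induce ((U : Set V)ᶜ)).Adj z v} := by linarith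
      exact_mod_cast h4
    rcases max_choice (G.degree x.1) (G.degree y.1) with h | h <;> rw [h] at h1
    · refine Or.inl ?_
      convert key x h1
    · refine Or.inr ?_
      convert key y h1
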